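/- arXiv:2302.12588 — 2 statements merged into one kernel-verified Lean document; each statement's English description precedes it below -/
import Mathlib

section
/- Let P be a 3-dimensional sphere packing with generic radii whose contact graph G is chordal. Then P is stress-free. -/
noncomputable section

/-- A `d`-dimensional sphere packing with contact graph `G`, centres `p` and radii `r`:
the spheres have disjoint interiors and two spheres touch iff the vertices are adjacent. -/
def IsSpherePacking {V : Type*} (d : ℕ) (G : SimpleGraph V)
    (p : V → EuclideanSpace ℝ (Fin d)) (r : V → ℝ) : Prop :=
  (∀ v, 0 < r v) ∧
  ∀ v w : V, v ≠ w →
    r v + r w ≤ dist (p v) (p w) ∧ (dist (p v) (p w) = r v + r w ↔ G.Adj v w)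

/-- The radii are generic: injective and algebraically independent over `ℚ`. -/
def GenericRadii {V : Type*} (r : V → ℝ) : Prop :=
  Function.Injective r ∧ AlgebraicIndependent ℚ r

/-- The framework `(G, p)` is stress-free: every equilibrium stress
(a symmetric assignment of scalars to edges whose weighted differences sum to zero
at every vertex) is identically zero. -/
def IsStressFree {V : Type*} [Fintype V] {d : ℕ} (G : SimpleGraph V)
    (p : V → EuclideanSpace ℝ (Fin d)) : Prop :=
  ∀ σ : V → V → ℝ,
    (∀ v w, σ v w = σ w v) →
    (∀ v w, ¬ G.Adj v w → σ v w = 0) →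
    (∀ v, ∑ w : V, σ v w • (p v - p w) = 0) →
    ∀ v w, σ v w = 0

/-- A graph is chordal if every cycle of length at least 4 has a chord: two vertices of
the cycle that are adjacent in the graph but whose edge is not an edge of the cycle. -/
def IsChordal {V : Type*} (G : SimpleGraph V) : Prop :=
  ∀ (v : V) (c : G.Walk v v), c.IsCycle → 4 ≤ c.length →
    ∃ u w : V, u ∈ c.support ∧ w ∈ c.support ∧ G.Adj u w ∧ s(u, w) ∉ c.edges

open Finset

/-- The Descartes polynomial of a finite set of radii, with denominators cleared. -/
def descartesPoly {V : Type*} [DecidableEq V] (Q : Finset V) : MvPolynomial V ℚ :=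
  ((Q.card : MvPolynomial V ℚ) - 2) * ∑ i ∈ Q, (∏ j ∈ Q.erase i, MvPolynomial.X j) ^ 2 -
    (∑ i ∈ Q, ∏ j ∈ Q.erase i, MvPolynomial.X j) ^ 2

lemma descartesPoly_ne_zero {V : Type*} [DecidableEq V] {Q : Finset V} (hQ : Q.Nonempty) :
    descartesPoly Q ≠ 0 := by
  intro h
  have h1 := congrArg (MvPolynomial.eval fun _ => (1 : ℚ)) h
  simp only [descartesPoly, map_sub, map_mul, map_natCast, map_ofNat, map_sum, map_pow, map_prod,
    MvPolynomial.eval_X, prod_const_one, one_pow, sum_const, nsmul_eq_mul, mul_one,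
    map_zero] at h1
  have h2 : (0 : ℚ) < Q.card := by exact_mod_cast hQ.card_pos
  nlinarith

/-- Descartes' relation fails for generic radii. -/
lemma descartes_ne {V : Type*} {r : V → ℝ} (hpos : ∀ v, 0 < r v)
    (hr : AlgebraicIndependent ℚ r) {Q : Finset V} (hQ : Q.Nonempty) :
    ((Q.card : ℝ) - 2) * ∑ i ∈ Q, (r i)⁻¹ ^ 2 ≠ (∑ i ∈ Q, (r i)⁻¹) ^ 2 := by
  classical
  intro h
  refine descartesPoly_ne_zero hQ (hr.eq_zero_of_aeval_eq_zero _ ?_)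
  have hprod : ∀ i ∈ Q, ∏ j ∈ Q.erase i, r j = (∏ j ∈ Q, r j) * (r i)⁻¹ := by
    intro i hi
    rw [← mul_prod_erase Q r hi]
    field_simp [(hpos i).ne']
  simp only [descartesPoly, map_sub, map_mul, map_natCast, map_ofNat, map_sum, map_pow, map_prod,
    MvPolynomial.aeval_X]
  rw [sum_congr rfl hprod, sum_congr rfl fun i hi => by rw [hprod i hi, mul_pow],
    ← mul_sum, ← mul_sum]
  linear_combination (∏ j ∈ Q, r j) ^ 2 * h

/-- The centres of mutually tangent spheres with generic radii are affinely independent. -/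
lemma affine_coeff_eq_zero_of_tangent {V E : Type*} [NormedAddCommGroup E]
    [InnerProductSpace ℝ E] {p : V → E} {r : V → ℝ} (hpos : ∀ v, 0 < r v)
    (hr : AlgebraicIndependent ℚ r) {Q : Finset V}
    (hQ : ∀ i ∈ Q, ∀ j ∈ Q, i ≠ j → dist (p i) (p j) = r i + r j)
    {c : V → ℝ} (hc : ∑ i ∈ Q, c i = 0) (hcp : ∑ i ∈ Q, c i • p i = 0) :
    ∀ i ∈ Q, c i = 0 := by
  classical
  rcases Q.eq_empty_or_nonempty with rfl | hne
  · simp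
  obtain ⟨A, B, hA, hAB⟩ : ∃ A B : ℝ, 2 * A = ∑ i ∈ Q, c i * r i ∧
      ∀ i ∈ Q, c i = A * (r i)⁻¹ + B * (r i)⁻¹ ^ 2 := by
    refine ⟨(∑ i ∈ Q, c i * r i) / 2,
      ((∑ j ∈ Q, c j * r j ^ 2) - ∑ j ∈ Q, c j * ‖p j‖ ^ 2) / 4, by ring, fun i hi => ?_⟩
    have h1 : ∑ j ∈ Q, c j * dist (p i) (p j) ^ 2 = ∑ j ∈ Q, c j * ‖p j‖ ^ 2 := by
      have h : ∀ j ∈ Q, c j * dist (p i) (p j) ^ 2 =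
          c j * ‖p i‖ ^ 2 - 2 * inner ℝ (p i) (c j • p j) + c j * ‖p j‖ ^ 2 := by
        intro j _
        rw [dist_eq_norm, norm_sub_sq_real, inner_smul_right]
        ring
      rw [sum_congr rfl h, sum_add_distrib, sum_sub_distrib, ← sum_mul, ← mul_sum, ← inner_sum,
        hc, hcp]
      simp
    have h2 : ∑ j ∈ Q, c j * dist (p i) (p j) ^ 2 =
        ∑ j ∈ Q, (c j * r i ^ 2 + 2 * r i * (c j * r j) + c j * r j ^ 2 -
          if i = j then 4 * c j * r j ^ 2 else 0) := by
      refine sum_congr rfl fun j hj => ?_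
      split_ifs with h
      · subst h
        rw [dist_self]
        ring
      · rw [hQ i hi j hj h]
        ring
    rw [sum_sub_distrib, sum_add_distrib, sum_add_distrib, ← sum_mul, ← mul_sum, hc,
      sum_ite_eq, if_pos hi] at h2
    have := (hpos i).ne'
    field_simp
    linarith
  set X := ∑ i ∈ Q, (r i)⁻¹ with hX
  set Y := ∑ i ∈ Q, (r i)⁻¹ ^ 2 with hY
  have e1 : A * X + B * Y = 0 := by
    rw [sum_congr rfl hAB, sum_add_distrib, ← mul_sum, ← mul_sum] at hc
    exact hc
  have e2 : ((Q.card : ℝ) - 2) * A + B * X = 0 := by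
    have h : ∀ i ∈ Q, c i * r i = A + B * (r i)⁻¹ := by
      intro i hi
      have := (hpos i).ne'
      rw [hAB i hi]
      field_simp
    rw [sum_congr rfl h, sum_add_distrib, ← mul_sum, sum_const, nsmul_eq_mul] at hA
    linarith
  have hdet : ((Q.card : ℝ) - 2) * Y - X ^ 2 ≠ 0 := sub_ne_zero.2 (descartes_ne hpos hr hne)
  have hA0 : A = 0 := by
    refine (mul_eq_zero.1 ?_).resolve_right hdet
    linear_combination Y * e2 - X * e1
  have hB0 : B = 0 := by
    refine (mul_eq_zero.1 ?_).resolve_right hdet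
    linear_combination ((Q.card : ℝ) - 2) * e1 - X * e2
  intro i hi
  rw [hAB i hi, hA0, hB0]
  ring

/-- A walk realizing the distance has no chord. -/
lemma SimpleGraph.Walk.mem_edges_of_adj_of_length_eq_dist {V : Type*} {H : SimpleGraph V}
    {x y : V} (q : H.Walk x y) (hq : q.length = H.dist x y) {a b : V} (ha : a ∈ q.support)
    (hb : b ∈ q.support) (hab : H.Adj a b) : s(a, b) ∈ q.edges := by
  have key : ∀ i j, i < j → j ≤ q.length → H.Adj (q.getVert i) (q.getVert j) → j = i + 1 := by
    intro i j hij hj hadj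
    have h := SimpleGraph.dist_le ((q.take i).append (.cons hadj (q.drop j)))
    rw [SimpleGraph.Walk.length_append, SimpleGraph.Walk.length_cons,
      SimpleGraph.Walk.take_length, SimpleGraph.Walk.drop_length] at h
    omega
  obtain ⟨i, rfl, hi⟩ := SimpleGraph.Walk.mem_support_iff_exists_getVert.1 ha
  obtain ⟨j, rfl, hj⟩ := SimpleGraph.Walk.mem_support_iff_exists_getVert.1 hb
  rw [SimpleGraph.Walk.mk_mem_edges_iff_exists]
  rcases lt_trichotomy i j with h | rfl | h
  · obtain rfl := key i j h hj hab
    exact ⟨i, by omega, rfl⟩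
  · exact (hab.ne rfl).elim
  · obtain rfl := key j i h hi hab.symm
    exact ⟨j, by omega, Sym2.eq_swap⟩

lemma SimpleGraph.Walk.support_subset_of_adj_imp {V : Type*} {H : SimpleGraph V} {W : Set V}
    (hH : ∀ a b, H.Adj a b → a ∈ W) {x y : V} (q : H.Walk x y) (hy : y ∈ W) :
    ∀ a ∈ q.support, a ∈ W := by
  induction q with
  | nil => simpa using hy
  | cons h q ih =>
    intro a ha
    rw [SimpleGraph.Walk.support_cons, List.mem_cons] at ha
    rcases ha with rfl | ha
    · exact hH _ _ h
    · exact ih hy a ha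

/-- In a chordal graph, two neighbours of `v` joined by a walk avoiding the other neighbours of
`v` and `v` itself are adjacent. -/
lemma IsChordal.adj_of_reachable {V : Type*} {G : SimpleGraph V} (hG : IsChordal G) {v x y : V}
    (hxy : x ≠ y) (hvx : G.Adj v x) (hvy : G.Adj v y) {D : Set V}
    (hD : ∀ d ∈ D, d ≠ v ∧ ¬ G.Adj v d)
    (hreach : ((⊤ : G.Subgraph).induce (insert x (insert y D))).spanningCoe.Reachable x y) :
    G.Adj x y := by
  set W := insert x (insert y D) with hW
  set H := ((⊤ : G.Subgraph).induce W).spanningCoe with hH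
  have hadj : ∀ a b, H.Adj a b ↔ a ∈ W ∧ b ∈ W ∧ G.Adj a b := by simp [hH]
  by_contra hnot
  obtain ⟨q, hqp, hq⟩ := hreach.exists_path_of_dist
  have hle : H ≤ G := SimpleGraph.Subgraph.spanningCoe_le _
  have hlt := hreach.one_lt_dist_of_ne_of_not_adj hxy fun h => hnot (hle h)
  have hsupp := q.support_subset_of_adj_imp (fun a b h => ((hadj a b).1 h).1)
    (by simp [hW] : y ∈ W)
  have hv : v ∉ q.support := by
    intro h
    rcases hsupp v h with h | h | h
    · exact hvx.ne h
    · exact hvy.ne h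
    · exact (hD v h).1 rfl
  set q' := (q.mapLe hle).concat hvy.symm with hq'
  have hsup : ∀ a, a ∈ (SimpleGraph.Walk.cons hvx q').support ↔ a = v ∨ a ∈ q.support := by
    intro a
    simp [hq', SimpleGraph.Walk.support_concat, or_comm]
  have hedge : ∀ e, e ∈ (SimpleGraph.Walk.cons hvx q').edges ↔
      e = s(v, x) ∨ e ∈ q.edges ∨ e = s(y, v) := by
    intro e
    simp [hq', SimpleGraph.Walk.edges_concat]
  have hcyc : (SimpleGraph.Walk.cons hvx q').IsCycle := by
    rw [SimpleGraph.Walk.cons_isCycle_iff]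
    refine ⟨SimpleGraph.Walk.IsPath.concat ((SimpleGraph.Walk.isPath_mapLe hle).2 hqp)
      (by simpa using hv) _, ?_⟩
    intro h
    have h' : s(v, x) ∈ q.edges ∨ s(v, x) = s(y, v) := by
      simpa [hq', SimpleGraph.Walk.edges_concat] using h
    rcases h' with h' | h'
    · exact hv (q.fst_mem_support_of_mem_edges h')
    · rw [Sym2.eq_swap, Sym2.congr_left] at h'
      exact hxy h'
  have hlen : 4 ≤ (SimpleGraph.Walk.cons hvx q').length := by
    simp [hq', SimpleGraph.Walk.length_concat]
    omega
  obtain ⟨a, b, ha, hb, hab, hnotin⟩ := hG v _ hcyc hlen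
  rw [hedge] at hnotin
  push Not at hnotin
  have hnbr : ∀ b ∈ q.support, G.Adj v b → b = x ∨ b = y := by
    intro b hb h
    rcases hsupp b hb with h' | h' | h'
    · exact .inl h'
    · exact .inr h'
    · exact ((hD b h').2 h).elim
  rcases (hsup a).1 ha with rfl | ha' <;> rcases (hsup b).1 hb with rfl | hb'
  · exact hab.ne rfl
  · rcases hnbr b hb' hab with rfl | rfl
    · exact hnotin.1 rfl
    · exact hnotin.2.2 Sym2.eq_swap
  · rcases hnbr a ha' hab.symm with rfl | rfl
    · exact hnotin.1 Sym2.eq_swap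
    · exact hnotin.2.2 rfl
  · exact hnotin.2.1 (q.mem_edges_of_adj_of_length_eq_dist hq ha' hb'
      ((hadj a b).2 ⟨hsupp a ha', hsupp b hb', hab⟩))

/-- Dirac's theorem: outside any clique not exhausting a vertex set `S` of a chordal graph there
is a vertex that is simplicial in the subgraph induced on `S`. -/
lemma IsChordal.exists_simplicial {V : Type*} {G : SimpleGraph V} (hG : IsChordal G)
    (S K : Finset V) (hKS : K ⊂ S) (hK : G.IsClique (K : Set V)) :
    ∃ v ∈ S, v ∉ K ∧ G.IsClique {w | w ∈ S ∧ G.Adj v w} := by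
  classical
  induction S using Finset.strongInduction generalizing K with
  | H S ih =>
  by_cases hS : G.IsClique (S : Set V)
  · obtain ⟨v, hv, hvK⟩ := exists_of_ssubset hKS
    exact ⟨v, hv, hvK, hS.subset fun w hw => hw.1⟩
  obtain ⟨v, hvS, hKv, c₀, hc₀S, hc₀v, hc₀⟩ : ∃ v ∈ S, (∀ k ∈ K, k = v ∨ G.Adj v k) ∧
      ∃ c ∈ S, c ≠ v ∧ ¬ G.Adj v c := by
    by_cases h : ∃ v ∈ K, ∃ c ∈ S, c ≠ v ∧ ¬ G.Adj v c
    · obtain ⟨v, hv, hc⟩ := h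
      refine ⟨v, hKS.1 hv, fun k hk => ?_, hc⟩
      by_cases hkv : k = v
      · exact .inl hkv
      · exact .inr (hK hv hk (Ne.symm hkv))
    · push Not at h
      rw [SimpleGraph.isClique_iff, Set.Pairwise] at hS
      push Not at hS
      obtain ⟨v, hv, c, hc, hne, hadj⟩ := hS
      refine ⟨v, hv, fun k hk => ?_, c, hc, hne.symm, hadj⟩
      by_cases hkv : k = v
      · exact .inl hkv
      · exact .inr (h k hk v hv (Ne.symm hkv)).symm
  set D : Set V := {d | d ∈ S ∧ d ≠ v ∧ ¬ G.Adj v d} with hD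
  set H := ((⊤ : G.Subgraph).induce D).spanningCoe with hH
  have hadj : ∀ a b, H.Adj a b ↔ a ∈ D ∧ b ∈ D ∧ G.Adj a b := by simp [hH]
  set C : Finset V := {w ∈ S | w ∈ D ∧ H.Reachable c₀ w} with hC
  set N : Finset V := {x ∈ S | x ∉ C ∧ ∃ c ∈ C, G.Adj x c} with hN
  have hCmem : ∀ w, w ∈ C ↔ w ∈ D ∧ H.Reachable c₀ w := by
    intro w
    simp only [hC, mem_filter, and_iff_right_iff_imp]
    exact fun h => h.1.1
  have hNv : ∀ x ∈ N, G.Adj v x := by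
    intro x hx
    obtain ⟨hxS, hxC, c, hc, hxc⟩ := by simpa only [hN, mem_filter] using hx
    rw [hCmem] at hc
    by_contra hvx
    by_cases hxv : x = v
    · subst hxv
      exact hc.1.2.2 hxc
    · have hxD : x ∈ D := ⟨hxS, hxv, hvx⟩
      exact hxC ((hCmem x).2 ⟨hxD, hc.2.trans
        (SimpleGraph.Adj.reachable ((hadj c x).2 ⟨hc.1, hxD, hxc.symm⟩))⟩)
  have hNcl : G.IsClique (N : Set V) := by
    intro x hx y hy hxy
    refine hG.adj_of_reachable hxy (hNv x hx) (hNv y hy) (D := D) (fun d hd => hd.2) ?_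
    obtain ⟨-, -, c, hc, hxc⟩ := by simpa only [hN, mem_coe, mem_filter] using hx
    obtain ⟨-, -, d, hd, hyd⟩ := by simpa only [hN, mem_coe, mem_filter] using hy
    rw [hCmem] at hc hd
    have hmono : H ≤ ((⊤ : G.Subgraph).induce (insert x (insert y D))).spanningCoe := by
      intro a b hab
      rw [hadj] at hab
      simp [hab.1, hab.2.1, hab.2.2]
    have h1 : ((⊤ : G.Subgraph).induce (insert x (insert y D))).spanningCoe.Adj x c := by
      simp [hc.1, hxc]
    have h2 : ((⊤ : G.Subgraph).induce (insert x (insert y D))).spanningCoe.Adj y d := by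
      simp [hd.1, hyd]
    exact h1.reachable.trans (((hc.2.symm.trans hd.2).mono hmono).trans h2.reachable.symm)
  have hc₀C : c₀ ∈ C := (hCmem c₀).2 ⟨⟨hc₀S, hc₀v, hc₀⟩, .refl _⟩
  have hCS : C ⊆ S := filter_subset _ _
  have hNS : N ⊆ S := filter_subset _ _
  have hNC : ∀ x ∈ N, x ∉ C := fun x hx => (mem_filter.1 hx).2.1
  have hTS : C ∪ N ⊂ S := by
    refine (ssubset_iff_of_subset (union_subset hCS hNS)).2 ⟨v, hvS, fun h => ?_⟩
    rcases mem_union.1 h with h | h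
    · exact ((hCmem v).1 h).1.2.1 rfl
    · exact (hNv v h).ne rfl
  have hNT : N ⊂ C ∪ N :=
    (ssubset_iff_of_subset subset_union_right).2
      ⟨c₀, mem_union_left _ hc₀C, fun h => hNC _ h hc₀C⟩
  obtain ⟨w, hwT, hwN, hw⟩ := ih _ hTS N hNT hNcl
  have hwC : w ∈ C := (mem_union.1 hwT).resolve_right hwN
  refine ⟨w, hCS hwC, fun hwK => ?_, SimpleGraph.IsClique.subset ?_ hw⟩
  · have hwD := ((hCmem w).1 hwC).1
    rcases hKv w hwK with h | h
    · exact hwD.2.1 h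
    · exact hwD.2.2 h
  · intro u hu
    refine ⟨?_, hu.2⟩
    by_cases huC : u ∈ C
    · exact mem_union_left _ huC
    · exact mem_union_right _ (mem_filter.2 ⟨hu.1, huC, w, hwC, hu.2.symm⟩)

/-- A stress vanishes at a vertex whose stressed neighbours form a clique. -/
lemma stress_eq_zero_of_isClique {V : Type*} [Fintype V] {d : ℕ} {G : SimpleGraph V}
    {p : V → EuclideanSpace ℝ (Fin d)} {r : V → ℝ} (hP : IsSpherePacking d G p r)
    (hr : GenericRadii r) {v : V} {N : Set V} (hN : G.IsClique N) (hvN : ∀ w ∈ N, G.Adj v w)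
    {f : V → ℝ} (hf : ∀ w, w ∉ N → f w = 0) (hsum : ∑ w, f w • (p v - p w) = 0) (w : V) :
    f w = 0 := by
  classical
  by_cases hw : w ∈ N
  swap
  · exact hf w hw
  have hvnot : v ∉ N := fun h => (hvN v h).ne rfl
  have hcl : G.IsClique (insert v N) := hN.insert fun b hb _ => hvN b hb
  set Q : Finset V := {u | u ∈ insert v N} with hQ
  set c : V → ℝ := fun u => f u - if u = v then ∑ t, f t else 0 with hc
  have hcQ : ∀ u, u ∉ Q → c u = 0 := by
    intro u hu
    simp only [hQ, mem_filter_univ, Set.mem_insert_iff, not_or] at hu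
    simp [hc, hu.1, hf u hu.2]
  have h1 : ∑ u ∈ Q, c u = 0 := by
    rw [sum_subset (subset_univ Q) fun u _ hu => hcQ u hu]
    simp [hc]
  have h2 : ∑ u ∈ Q, c u • p u = 0 := by
    rw [sum_subset (subset_univ Q) fun u _ hu => by rw [hcQ u hu, zero_smul]]
    simp only [smul_sub, sum_sub_distrib, ← sum_smul] at hsum
    simp only [hc, sub_smul, ite_smul, zero_smul, sum_sub_distrib, sum_ite_eq', mem_univ, if_true]
    rw [← neg_sub, hsum, neg_zero]
  have h := affine_coeff_eq_zero_of_tangent hP.1 hr.2 (Q := Q) (p := p)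
    (fun i hi j hj hij => ((hP.2 i j hij).2).2
      (hcl (by simpa [hQ] using hi) (by simpa [hQ] using hj) hij)) h1 h2 w (by simp [hQ, hw])
  have hwv : w ≠ v := fun h => hvnot (h ▸ hw)
  simpa [hc, hwv] using h

/-- A generic-radii sphere packing whose contact graph is chordal is stress-free. -/
theorem stressFree_of_generic_chordal {V : Type*} [Fintype V] (G : SimpleGraph V)
    (p : V → EuclideanSpace ℝ (Fin 3)) (r : V → ℝ)
    (hP : IsSpherePacking 3 G p r) (hr : GenericRadii r) (hchordal : IsChordal G) :
    IsStressFree G p := by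
  classical
  intro σ hsymm hnadj heq
  have key : ∀ S : Finset V, (∀ v w, v ∉ S → σ v w = 0) → ∀ v w, σ v w = 0 := by
    intro S
    induction S using Finset.strongInduction with
    | H S ih =>
    intro hS
    rcases S.eq_empty_or_nonempty with rfl | hne
    · exact fun v w => hS v w (notMem_empty v)
    obtain ⟨v, hvS, -, hv⟩ := hchordal.exists_simplicial S ∅ (empty_ssubset.2 hne) (by simp)
    refine ih (S.erase v) (erase_ssubset hvS) fun u w hu => ?_
    by_cases huS : u ∈ S
    · obtain rfl : u = v := by simpa [huS] using hu
      refine stress_eq_zero_of_isClique hP hr hv (fun w hw => hw.2) (fun w hw => ?_) (heq u) w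
      by_cases hadj : G.Adj u w
      · rw [hsymm]
        exact hS w u fun h => hw ⟨h, hadj⟩
      · exact hnadj u w hadj
    · exact hS u w huS
  exact key univ fun v _ hv => (hv (mem_univ v)).elim

end
end

section
/- Let G=(V,E) be the contact graph of a 2-dimensional sphere packing (circle packing) P with generic radii. Then P is stress-free; consequently |E| ≤ 2|V| − 3 whenever |V| ≥ 2. -/
noncomputable section

theorem exists_derivation_of_isTranscendenceBasis {F L ι : Type*} [Field F] [CharZero F] [Field L]
    [Algebra F L] {x : ι → L} (hx : IsTranscendenceBasis F x) (c : ι → L) :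
    ∃ D : Derivation F L L, ∀ i, D (x i) = c i := by
  let A := MvPolynomial ι F
  let : Algebra A L := (MvPolynomial.aeval x).toAlgebra
  have hA : ∀ P : A, algebraMap A L P = MvPolynomial.aeval x P := fun _ => rfl
  have : IsScalarTower F A L := IsScalarTower.of_algebraMap_eq fun t => by
    rw [hA]; exact ((MvPolynomial.aeval x).commutes t).symm
  have : FaithfulSMul A L := (faithfulSMul_iff_algebraMap_injective A L).2 hx.1
  have : Algebra.IsAlgebraic A L := by
    have := hx.isAlgebraic
    refine ⟨fun a => ?_⟩
    refine IsAlgebraic.of_ringHom_of_comp_eq (f := (hx.1.aevalEquiv : A →+* _))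
      (g := RingHom.id L) (S := Algebra.adjoin F (Set.range x)) (Algebra.IsAlgebraic.isAlgebraic _)
      hx.1.aevalEquiv.surjective Function.injective_id ?_
    refine RingHom.ext fun P => ?_
    exact hx.1.algebraMap_aevalEquiv P
  let : Algebra (FractionRing A) L := FractionRing.liftAlgebra A L
  have : Algebra.IsAlgebraic (FractionRing A) L :=
    (IsFractionRing.comap_isAlgebraic_iff (A := A) (K := FractionRing A)).1 inferInstance
  have : CharZero A := inferInstanceAs (CharZero (MvPolynomial ι F))
  have : CharZero (FractionRing A) := inferInstance
  have : Algebra.FormallyEtale A (FractionRing A) :=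
    .of_isLocalization (nonZeroDivisors A)
  have : Algebra.FormallyEtale (FractionRing A) L := .of_isSeparable _ L
  have : Algebra.FormallyEtale A L := .comp A (FractionRing A) L
  let D₀ : Derivation F A L := MvPolynomial.mkDerivation F c
  let h := KaehlerDifferential.isBaseChange_of_formallyEtale F A L
  refine ⟨(h.lift D₀.liftKaehlerDifferential).compDer (KaehlerDifferential.D F L), fun i => ?_⟩
  have hi : x i = algebraMap A L (MvPolynomial.X i) := by simp [hA]
  have := h.lift_eq D₀.liftKaehlerDifferential (KaehlerDifferential.D F A (MvPolynomial.X i))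
  rw [KaehlerDifferential.map_D, ← hi] at this
  have hD : D₀ (MvPolynomial.X i) = c i := MvPolynomial.mkDerivation_X F c i
  rw [Derivation.liftKaehlerDifferential_comp_D, hD] at this
  exact this

theorem AlgebraicIndependent.exists_derivation {F L ι : Type*} [Field F] [CharZero F] [Field L]
    [Algebra F L] {x : ι → L} (hx : AlgebraicIndependent F x) (c : ι → L) :
    ∃ D : Derivation F L L, ∀ i, D (x i) = c i := by
  obtain ⟨t, hst, ht⟩ := exists_isTranscendenceBasis_superset hx.coe_range
  obtain ⟨D, hD⟩ := exists_derivation_of_isTranscendenceBasis ht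
    (fun y => Function.extend x c 0 (y : L))
  refine ⟨D, fun i => ?_⟩
  rw [hD ⟨x i, hst ⟨i, rfl⟩⟩]
  exact hx.injective.extend_apply c 0 i

theorem sum_sum_eq_zero_of_antisymm {V : Type*} [Fintype V] {a : V → V → ℝ}
    (ha : ∀ v w, a w v = -a v w) : ∑ v, ∑ w, a v w = 0 := by
  have h : ∑ v, ∑ w, a v w = -∑ v, ∑ w, a v w := by
    conv_lhs => rw [Finset.sum_comm]
    simp only [← Finset.sum_neg_distrib]
    exact Finset.sum_congr rfl fun v _ => Finset.sum_congr rfl fun w _ => ha v w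
  linarith

/-- Twice the signed area of the triangle with vertices `A`, `B`, `X`. -/
def planeCross (A B X : ℝ × ℝ) : ℝ := (B.1 - A.1) * (X.2 - A.2) - (B.2 - A.2) * (X.1 - A.1)

theorem planeCross_swap (A B X : ℝ × ℝ) : planeCross B A X = -planeCross A B X := by
  unfold planeCross; ring

theorem planeCross_self (A X : ℝ × ℝ) : planeCross A A X = 0 := by
  unfold planeCross; ring

theorem planeCross_add (A B X u : ℝ × ℝ) :
    planeCross A B (X + u) = planeCross A B X + ((B.1 - A.1) * u.2 - (B.2 - A.2) * u.1) := by
  simp only [planeCross, Prod.fst_add, Prod.snd_add]; ring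

theorem continuous_planeCross (A B : ℝ × ℝ) : Continuous (planeCross A B) := by
  unfold planeCross; fun_prop

/-- An equilibrium stress `ω` on a straight-line plane drawing `p` without vertical edges, such
that moreover the stresses at every vertex, weighted by edge lengths, sum to zero. -/
structure IsPlaneBalancedStress {V : Type*} [Fintype V] (p : V → ℝ × ℝ) (ω : V → V → ℝ) :
    Prop where
  fst_injective : Function.Injective fun v => (p v).1
  symm : ∀ v w, ω v w = ω w v
  sum_fst : ∀ v, ∑ w, ω v w * ((p w).1 - (p v).1) = 0
  sum_snd : ∀ v, ∑ w, ω v w * ((p w).2 - (p v).2) = 0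
  sum_length : ∀ v, ∑ w, ω v w * √(((p w).1 - (p v).1) ^ 2 + ((p w).2 - (p v).2) ^ 2) = 0
  planeCross_vertex_ne_zero : ∀ i v w, ω v w ≠ 0 → (p v).1 < (p i).1 → (p i).1 < (p w).1 →
    planeCross (p v) (p w) (p i) ≠ 0
  eq_of_planeCross_eq_zero : ∀ v w v' w' (X : ℝ × ℝ), ω v w ≠ 0 → ω v' w' ≠ 0 →
    (p v).1 < X.1 → X.1 < (p w).1 → (p v').1 < X.1 → X.1 < (p w').1 →
    planeCross (p v) (p w) X = 0 → planeCross (p v') (p w') X = 0 → v = v' ∧ w = w'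

section Lift

variable {V : Type*} [Fintype V] (p : V → ℝ × ℝ) (ω : V → V → ℝ)

/-- The contribution of the vertex `v` to the lift of the stress `ω`. -/
def vertexLift (v : V) (X : ℝ × ℝ) : ℝ :=
  ∑ w, ω v w * (SignType.sign ((p w).1 - (p v).1) : ℝ) * |planeCross (p v) (p w) X|

/-- The Maxwell–Cremona lift of the stress `ω`: a piecewise linear function whose gradient jumps
across every edge by an amount proportional to the stress of this edge. -/
def stressLift (X : ℝ × ℝ) : ℝ :=
  ∑ v, if (p v).1 ≤ X.1 then vertexLift p ω v X else 0

/-- The sum of the terms `ω v w * |planeCross (p v) (p w) X|` over the edges crossing the vertical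
line with abscissa `c`. -/
def sliceLift (c : ℝ) (X : ℝ × ℝ) : ℝ :=
  ∑ v, ∑ w, if (p v).1 ≤ c ∧ c < (p w).1 then ω v w * |planeCross (p v) (p w) X| else 0

variable {p ω}

theorem sum_ite_sum_of_antisymm (P : V → Prop) [DecidablePred P] (g : V → V → ℝ)
    (hg : ∀ v w, g w v = -g v w) :
    ∑ v, (if P v then ∑ w, g v w else 0) = ∑ v, ∑ w, if P v ∧ ¬ P w then g v w else 0 := by
  have h0 : ∑ v, ∑ w, (if P v ∧ P w then g v w else 0) = 0 :=
    sum_sum_eq_zero_of_antisymm fun v w => by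
      by_cases h1 : P v <;> by_cases h2 : P w <;> simp [h1, h2, hg v w]
  have h1 : ∑ v, (if P v then ∑ w, g v w else 0) =
      (∑ v, ∑ w, if P v ∧ ¬ P w then g v w else 0) + ∑ v, ∑ w, if P v ∧ P w then g v w else 0 := ?_
  · rw [h1, h0, add_zero]
  rw [← Finset.sum_add_distrib]
  refine Finset.sum_congr rfl fun v _ => ?_
  rw [← Finset.sum_add_distrib]
  by_cases h1 : P v
  · simp only [h1, if_true, true_and]
    refine Finset.sum_congr rfl fun w _ => ?_
    by_cases h2 : P w <;> simp [h2]
  · simp [h1]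

theorem sum_ite_vertexLift (hω : ∀ v w, ω v w = ω w v) (c : ℝ) (X : ℝ × ℝ) :
    ∑ v, (if (p v).1 ≤ c then vertexLift p ω v X else 0) = sliceLift p ω c X := by
  unfold vertexLift sliceLift
  rw [sum_ite_sum_of_antisymm]
  · refine Finset.sum_congr rfl fun v _ => Finset.sum_congr rfl fun w _ => ?_
    simp only [not_le]
    split_ifs with h
    · rw [sign_pos (by linarith)]; simp
    · rfl
  · intro v w
    rw [planeCross_swap, abs_neg, hω w v, ← neg_sub, Left.sign_neg]
    push_cast; ring

theorem stressLift_eq_sliceLift (hω : ∀ v w, ω v w = ω w v) (X : ℝ × ℝ) :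
    stressLift p ω X = sliceLift p ω X.1 X :=
  sum_ite_vertexLift hω X.1 X

theorem continuous_vertexLift (v : V) : Continuous (vertexLift p ω v) :=
  continuous_finsetSum _ fun _ _ => continuous_const.mul (continuous_planeCross _ _).abs

theorem stressLift_neg (X : ℝ × ℝ) :
    stressLift p (fun v w => -ω v w) X = -stressLift p ω X := by
  simp only [stressLift, vertexLift, ← Finset.sum_neg_distrib]
  refine Finset.sum_congr rfl fun v _ => ?_
  split_ifs <;> simp

namespace IsPlaneBalancedStress

variable (h : IsPlaneBalancedStress p ω)
include h

theorem neg : IsPlaneBalancedStress p (fun v w => -ω v w) where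
  fst_injective := h.fst_injective
  symm v w := by rw [h.symm]
  sum_fst v := by simpa using h.sum_fst v
  sum_snd v := by simpa using h.sum_snd v
  sum_length v := by simpa using h.sum_length v
  planeCross_vertex_ne_zero i v w hω := h.planeCross_vertex_ne_zero i v w (by simpa using hω)
  eq_of_planeCross_eq_zero v w v' w' X h1 h2 :=
    h.eq_of_planeCross_eq_zero v w v' w' X (by simpa using h1) (by simpa using h2)

theorem sum_mul_planeCross (v : V) (X : ℝ × ℝ) : ∑ w, ω v w * planeCross (p v) (p w) X = 0 := by
  have : ∑ w, ω v w * planeCross (p v) (p w) X =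
      (∑ w, ω v w * ((p w).1 - (p v).1)) * (X.2 - (p v).2) -
        (∑ w, ω v w * ((p w).2 - (p v).2)) * (X.1 - (p v).1) := by
    rw [Finset.sum_mul, Finset.sum_mul, ← Finset.sum_sub_distrib]
    exact Finset.sum_congr rfl fun w _ => by unfold planeCross; ring
  rw [this, h.sum_fst, h.sum_snd]; ring

theorem vertexLift_eq_zero_of_fst_eq {v : V} {X : ℝ × ℝ} (hX : (p v).1 = X.1) :
    vertexLift p ω v X = 0 := by
  have : vertexLift p ω v X = (∑ w, ω v w * ((p w).1 - (p v).1)) * |X.2 - (p v).2| := by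
    rw [vertexLift, Finset.sum_mul]
    refine Finset.sum_congr rfl fun w _ => ?_
    rw [show planeCross (p v) (p w) X = ((p w).1 - (p v).1) * (X.2 - (p v).2) by
      rw [planeCross, hX]; ring, abs_mul]
    linear_combination (ω v w * |X.2 - (p v).2|) * sign_mul_abs ((p w).1 - (p v).1)
  rw [this, h.sum_fst, zero_mul]

theorem continuous_stressLift : Continuous (stressLift p ω) := by
  refine continuous_finsetSum _ fun v _ => ?_
  exact Continuous.if_le (continuous_vertexLift v) continuous_const continuous_const
    continuous_fst fun X hX => h.vertexLift_eq_zero_of_fst_eq hX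

theorem eventually_vertexLift_eq_zero {v : V} {X : ℝ × ℝ} (hX : (p v).1 = X.1)
    (hne : (p v).2 ≠ X.2) : ∀ᶠ Y in nhds X, vertexLift p ω v Y = 0 := by
  have key : ∀ w, ∀ᶠ Y in nhds X,
      (SignType.sign ((p w).1 - (p v).1) : ℝ) * |planeCross (p v) (p w) Y| =
        (SignType.sign (X.2 - (p v).2) : ℝ) * planeCross (p v) (p w) Y := by
    intro w
    have hc : planeCross (p v) (p w) X = ((p w).1 - (p v).1) * (X.2 - (p v).2) := by
      rw [planeCross, hX]; ring
    have hcont := (continuous_planeCross (p v) (p w)).tendsto X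
    rcases lt_trichotomy ((p w).1) ((p v).1) with h1 | h1 | h1
    · rcases lt_or_gt_of_ne hne with h2 | h2
      · filter_upwards [hcont.eventually_lt_const
          (show planeCross (p v) (p w) X < 0 by rw [hc]; nlinarith)] with Y hY
        rw [sign_neg (by linarith), sign_pos (by linarith), abs_of_neg hY]; simp
      · filter_upwards [hcont.eventually_const_lt
          (show 0 < planeCross (p v) (p w) X by rw [hc]; nlinarith)] with Y hY
        rw [sign_neg (by linarith), sign_neg (by linarith), abs_of_pos hY]
    · rw [h.fst_injective h1]
      exact Filter.Eventually.of_forall fun Y => by simp [planeCross_self]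
    · rcases lt_or_gt_of_ne hne with h2 | h2
      · filter_upwards [hcont.eventually_const_lt
          (show 0 < planeCross (p v) (p w) X by rw [hc]; nlinarith)] with Y hY
        rw [sign_pos (by linarith), sign_pos (by linarith), abs_of_pos hY]
      · filter_upwards [hcont.eventually_lt_const
          (show planeCross (p v) (p w) X < 0 by rw [hc]; nlinarith)] with Y hY
        rw [sign_pos (by linarith), sign_neg (by linarith), abs_of_neg hY]; simp
  filter_upwards [Filter.eventually_all.2 key] with Y hY
  have : vertexLift p ω v Y =
      (SignType.sign (X.2 - (p v).2) : ℝ) * ∑ w, ω v w * planeCross (p v) (p w) Y := by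
    rw [vertexLift, Finset.mul_sum]
    exact Finset.sum_congr rfl fun w _ => by rw [mul_assoc, hY w]; ring
  rw [this, h.sum_mul_planeCross, mul_zero]

omit h in
theorem eventually_le_fst_iff {c : ℝ} {X : ℝ × ℝ} (hc : c ≠ X.1) :
    ∀ᶠ Y : ℝ × ℝ in nhds X, (c ≤ Y.1 ↔ c ≤ X.1) := by
  have hcont := (continuous_fst (X := ℝ) (Y := ℝ)).tendsto X
  rcases lt_or_gt_of_ne hc with h1 | h1
  · filter_upwards [hcont.eventually_const_lt h1] with Y hY
    exact iff_of_true hY.le h1.le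
  · filter_upwards [hcont.eventually_lt_const h1] with Y hY
    exact iff_of_false hY.not_ge h1.not_ge

theorem eventually_stressLift_eq_sliceLift {X : ℝ × ℝ} (hX : ∀ v, p v ≠ X) :
    ∀ᶠ Y in nhds X, stressLift p ω Y = sliceLift p ω X.1 Y := by
  have key : ∀ v, ∀ᶠ Y in nhds X, (if (p v).1 ≤ Y.1 then vertexLift p ω v Y else 0) =
      if (p v).1 ≤ X.1 then vertexLift p ω v Y else 0 := by
    intro v
    by_cases hv : (p v).1 = X.1
    · filter_upwards [h.eventually_vertexLift_eq_zero hv fun h2 => hX v (Prod.ext hv h2)]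
        with Y hY
      simp [hY]
    · filter_upwards [eventually_le_fst_iff hv] with Y hY
      simp only [hY]
  filter_upwards [Filter.eventually_all.2 key] with Y hY
  rw [← sum_ite_vertexLift h.symm, stressLift]
  exact Finset.sum_congr rfl fun v _ => hY v

/-- The second difference of the lift at a point that is not a vertex only sees the edges through
this point. -/
theorem eventually_second_difference {X : ℝ × ℝ} (hX : ∀ v, p v ≠ X) (u : ℝ × ℝ) :
    ∀ᶠ t : ℝ in nhds 0,
      stressLift p ω (X + t • u) + stressLift p ω (X - t • u) - 2 * stressLift p ω X =
        ∑ v, ∑ w, if ((p v).1 ≤ X.1 ∧ X.1 < (p w).1) ∧ planeCross (p v) (p w) X = 0 then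
          ω v w * (2 * |t| * |((p w).1 - (p v).1) * u.2 - ((p w).2 - (p v).2) * u.1|) else 0 := by
  have hp : Filter.Tendsto (fun t : ℝ => X + t • u) (nhds 0) (nhds X) := by
    have : Continuous fun t : ℝ => X + t • u := by fun_prop
    simpa using this.tendsto 0
  have hm : Filter.Tendsto (fun t : ℝ => X - t • u) (nhds 0) (nhds X) := by
    have : Continuous fun t : ℝ => X - t • u := by fun_prop
    simpa using this.tendsto 0
  have hE := h.eventually_stressLift_eq_sliceLift hX
  have key : ∀ v w, ∀ᶠ t : ℝ in nhds 0,
      |planeCross (p v) (p w) (X + t • u)| + |planeCross (p v) (p w) (X - t • u)| -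
        2 * |planeCross (p v) (p w) X| = if planeCross (p v) (p w) X = 0 then
          2 * |t| * |((p w).1 - (p v).1) * u.2 - ((p w).2 - (p v).2) * u.1| else 0 := by
    intro v w
    have e1 : ∀ t : ℝ, planeCross (p v) (p w) (X + t • u) = planeCross (p v) (p w) X +
        t * (((p w).1 - (p v).1) * u.2 - ((p w).2 - (p v).2) * u.1) := fun t => by
      rw [planeCross_add]; simp; ring
    have e2 : ∀ t : ℝ, planeCross (p v) (p w) (X - t • u) = planeCross (p v) (p w) X -
        t * (((p w).1 - (p v).1) * u.2 - ((p w).2 - (p v).2) * u.1) := fun t => by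
      rw [sub_eq_add_neg, planeCross_add]; simp; ring
    have hc := (continuous_planeCross (p v) (p w)).tendsto X
    split_ifs with h0
    · refine Filter.Eventually.of_forall fun t => ?_
      rw [e1, e2, h0, zero_add, zero_sub, abs_neg, abs_mul, abs_zero]; ring
    · rcases lt_or_gt_of_ne h0 with h1 | h1
      · filter_upwards [(hc.comp hp).eventually_lt_const h1, (hc.comp hm).eventually_lt_const h1]
          with t h2 h3
        simp only [Function.comp] at h2 h3
        rw [abs_of_neg h2, abs_of_neg h3, abs_of_neg h1, e1, e2]; ring
      · filter_upwards [(hc.comp hp).eventually_const_lt h1, (hc.comp hm).eventually_const_lt h1]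
          with t h2 h3
        simp only [Function.comp] at h2 h3
        rw [abs_of_pos h2, abs_of_pos h3, abs_of_pos h1, e1, e2]; ring
  filter_upwards [hp.eventually hE, hm.eventually hE,
    Filter.eventually_all.2 fun v => Filter.eventually_all.2 (key v)] with t h1 h2 h3
  rw [h1, h2, hE.self_of_nhds]
  simp only [sliceLift, Finset.mul_sum, ← Finset.sum_add_distrib, ← Finset.sum_sub_distrib]
  refine Finset.sum_congr rfl fun v _ => Finset.sum_congr rfl fun w _ => ?_
  have := h3 v w
  by_cases ha : (p v).1 ≤ X.1 ∧ X.1 < (p w).1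
  · by_cases h0 : planeCross (p v) (p w) X = 0
    · simp only [ha, h0, if_true, and_self] at this ⊢
      rw [← this]; ring
    · simp only [ha, h0, if_true, and_self, and_false, if_false] at this ⊢
      linear_combination (ω v w) * this
  · simp [ha]

end IsPlaneBalancedStress
end Lift

/-- A compactly supported continuous function on the plane that is positive somewhere has a
maximum at which it is not affine in any direction. -/
theorem exists_isMax_of_hasCompactSupport {f : ℝ × ℝ → ℝ} (hf : Continuous f)
    (hs : HasCompactSupport f) (hpos : ∃ X, 0 < f X) :
    ∃ X, (∀ Y, f Y ≤ f X) ∧ ∀ u, u ≠ 0 → f (X + u) + f (X - u) < 2 * f X := by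
  obtain ⟨Z, hZ⟩ := hf.exists_forall_ge_of_hasCompactSupport hs
  have hM : 0 < f Z := hpos.elim fun X hX => hX.trans_le (hZ X)
  have hK : IsCompact {X | f X = f Z} := by
    refine IsCompact.of_isClosed_subset hs (isClosed_eq hf continuous_const) fun X hX => ?_
    exact subset_tsupport f (by rw [Function.mem_support, show f X = f Z from hX]; exact hM.ne')
  obtain ⟨X, hX, hmax⟩ := hK.exists_isMaxOn ⟨Z, rfl⟩
    (f := fun X : ℝ × ℝ => X.1 ^ 2 + X.2 ^ 2) (by fun_prop)
  have hXZ : f X = f Z := hX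
  refine ⟨X, fun Y => hXZ ▸ hZ Y, fun u hu => ?_⟩
  by_contra! hle
  have h1 := hZ (X + u)
  have h2 := hZ (X - u)
  have h3 := hmax (show f (X + u) = f Z by linarith)
  have h4 := hmax (show f (X - u) = f Z by linarith)
  simp only [Set.mem_ofPred_eq, Prod.fst_add, Prod.snd_add, Prod.fst_sub, Prod.snd_sub] at h3 h4
  have h5 : u.1 = 0 := by nlinarith [sq_nonneg u.1, sq_nonneg u.2]
  have h6 : u.2 = 0 := by nlinarith [sq_nonneg u.1, sq_nonneg u.2]
  exact hu (Prod.ext h5 h6)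

namespace IsPlaneBalancedStress

variable {V : Type*} [Fintype V] {p : V → ℝ × ℝ} {ω : V → V → ℝ} (h : IsPlaneBalancedStress p ω)
include h

theorem sum_ite_mul_planeCross (X : ℝ × ℝ) (c : ℝ) :
    ∑ v, ∑ w, (if (p v).1 ≤ c ∧ c < (p w).1 then ω v w * planeCross (p v) (p w) X else 0) = 0 := by
  have := sum_ite_sum_of_antisymm (fun v => (p v).1 ≤ c)
    (fun v w => ω v w * planeCross (p v) (p w) X)
    (fun v w => by rw [h.symm, planeCross_swap, mul_neg])
  simp only [not_le, h.sum_mul_planeCross, ite_self, Finset.sum_const_zero] at this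
  exact this.symm

omit h in
theorem planeCross_eq_add (A B X : ℝ × ℝ) :
    planeCross A B X = (B.1 - X.1) * (X.2 - A.2) + (X.1 - A.1) * (X.2 - B.2) := by
  unfold planeCross; ring

theorem hasCompactSupport_stressLift : HasCompactSupport (stressLift p ω) := by
  refine HasCompactSupport.intro (isCompact_closedBall (0 : ℝ × ℝ) (∑ v, ‖p v‖)) fun X hX => ?_
  have hp : ∀ v, ‖p v‖ ≤ ∑ v, ‖p v‖ := fun v =>
    Finset.single_le_sum (f := fun v => ‖p v‖) (fun _ _ => norm_nonneg _) (Finset.mem_univ v)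
  have h1 : ∀ v, |(p v).1| ≤ ∑ v, ‖p v‖ := fun v => (norm_fst_le (p v)).trans (hp v)
  have h2 : ∀ v, |(p v).2| ≤ ∑ v, ‖p v‖ := fun v => (norm_snd_le (p v)).trans (hp v)
  generalize ∑ v, ‖p v‖ = R at *
  rw [mem_closedBall_zero_iff, not_le, Prod.norm_def, lt_max_iff, Real.norm_eq_abs,
    Real.norm_eq_abs, lt_abs, lt_abs] at hX
  rw [stressLift_eq_sliceLift h.symm, sliceLift]
  rcases hX with (hX | hX) | (hX | hX)
  · refine Finset.sum_eq_zero fun v _ => Finset.sum_eq_zero fun w _ => if_neg fun hw => ?_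
    linarith [(abs_le.1 (h1 w)).2, hw.2]
  · refine Finset.sum_eq_zero fun v _ => Finset.sum_eq_zero fun w _ => if_neg fun hw => ?_
    linarith [(abs_le.1 (h1 v)).1, hw.1]
  · refine Eq.trans ?_ (h.sum_ite_mul_planeCross X X.1)
    refine Finset.sum_congr rfl fun v _ => Finset.sum_congr rfl fun w _ => ?_
    split_ifs with hw
    · rw [abs_of_nonneg]
      rw [planeCross_eq_add]
      have := mul_nonneg (sub_nonneg.2 hw.2.le) (show 0 ≤ X.2 - (p v).2 by
        linarith [(abs_le.1 (h2 v)).2])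
      have := mul_nonneg (sub_nonneg.2 hw.1) (show 0 ≤ X.2 - (p w).2 by
        linarith [(abs_le.1 (h2 w)).2])
      linarith
    · rfl
  · refine Eq.trans ?_ (neg_eq_zero.2 (h.sum_ite_mul_planeCross X X.1))
    simp only [← Finset.sum_neg_distrib]
    refine Finset.sum_congr rfl fun v _ => Finset.sum_congr rfl fun w _ => ?_
    split_ifs with hw
    · rw [abs_of_nonpos, mul_neg]
      rw [planeCross_eq_add]
      have := mul_nonneg (sub_nonneg.2 hw.2.le) (show 0 ≤ (p v).2 - X.2 by
        linarith [(abs_le.1 (h2 v)).1])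
      have := mul_nonneg (sub_nonneg.2 hw.1) (show 0 ≤ (p w).2 - X.2 by
        linarith [(abs_le.1 (h2 w)).1])
      linarith
    · simp

omit h [Fintype V] in
theorem fst_lt_of_planeCross_eq_zero {v w : V} {X : ℝ × ℝ} (hX : p v ≠ X)
    (hw : (p v).1 ≤ X.1 ∧ X.1 < (p w).1) (h0 : planeCross (p v) (p w) X = 0) :
    (p v).1 < X.1 := by
  refine lt_of_le_of_ne hw.1 fun he => hX (Prod.ext he ?_)
  rw [planeCross, he, sub_self, mul_zero, sub_zero] at h0
  rcases mul_eq_zero.1 h0 with h0 | h0 <;> linarith [hw.2]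

theorem exists_second_difference_eq_zero {X : ℝ × ℝ} (hX : ∀ v, p v ≠ X) :
    ∃ u, u ≠ 0 ∧ stressLift p ω (X + u) + stressLift p ω (X - u) = 2 * stressLift p ω X := by
  suffices H : ∃ u : ℝ × ℝ, u ≠ 0 ∧ ∀ v w, (p v).1 ≤ X.1 ∧ X.1 < (p w).1 →
      planeCross (p v) (p w) X = 0 →
      ω v w * |((p w).1 - (p v).1) * u.2 - ((p w).2 - (p v).2) * u.1| = 0 by
    obtain ⟨u, hu, H⟩ := H
    obtain ⟨t, ht, ht0⟩ := ((Filter.Eventually.filter_mono nhdsWithin_le_nhds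
      (h.eventually_second_difference hX u)).and
      (self_mem_nhdsWithin : {(0 : ℝ)}ᶜ ∈ nhdsWithin 0 {(0 : ℝ)}ᶜ)).exists
    refine ⟨t • u, smul_ne_zero ht0 hu, ?_⟩
    rw [Finset.sum_eq_zero fun v _ => Finset.sum_eq_zero fun w _ => ?_] at ht
    · linarith
    split_ifs with hw
    · linear_combination (2 * |t|) * H v w hw.1 hw.2
    · rfl
  by_cases hE : ∃ v w, ω v w ≠ 0 ∧ ((p v).1 ≤ X.1 ∧ X.1 < (p w).1) ∧
      planeCross (p v) (p w) X = 0
  · obtain ⟨v, w, hω, hw, h0⟩ := hE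
    refine ⟨((p w).1 - (p v).1, (p w).2 - (p v).2), fun hu => ?_, fun v' w' hw' h0' => ?_⟩
    · have := congrArg Prod.fst hu
      simp only [Prod.fst_zero] at this
      linarith [hw.1, hw.2]
    · by_cases hω' : ω v' w' = 0
      · simp [hω']
      · obtain ⟨rfl, rfl⟩ := h.eq_of_planeCross_eq_zero v w v' w' X hω hω'
          (fst_lt_of_planeCross_eq_zero (hX v) hw h0) hw.2
          (fst_lt_of_planeCross_eq_zero (hX v') hw' h0') hw'.2 h0 h0'
        rw [mul_comm ((p w).2 - _), sub_self, abs_zero, mul_zero]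
  · push Not at hE
    refine ⟨(0, 1), by simp, fun v w hw h0 => ?_⟩
    rw [show ω v w = 0 from by_contra fun hω => hE v w hω hw h0, zero_mul]

theorem fst_ne {v w : V} (hvw : v ≠ w) : (p v).1 ≠ (p w).1 := h.fst_injective.ne hvw

omit h in
theorem eventually_fst_mem {a b : ℝ} {X : ℝ × ℝ} (ha : a < X.1) (hb : X.1 < b) :
    ∀ᶠ u : ℝ × ℝ in nhds 0, a < X.1 + u.1 ∧ X.1 + u.1 < b ∧ a < X.1 - u.1 ∧ X.1 - u.1 < b := by
  have h1 : Filter.Tendsto (fun u : ℝ × ℝ => X.1 + u.1) (nhds 0) (nhds X.1) := by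
    have : Continuous fun u : ℝ × ℝ => X.1 + u.1 := by fun_prop
    simpa using this.tendsto 0
  have h2 : Filter.Tendsto (fun u : ℝ × ℝ => X.1 - u.1) (nhds 0) (nhds X.1) := by
    have : Continuous fun u : ℝ × ℝ => X.1 - u.1 := by fun_prop
    simpa using this.tendsto 0
  exact (h1.eventually_const_lt ha).and ((h1.eventually_lt_const hb).and
    ((h2.eventually_const_lt ha).and (h2.eventually_lt_const hb)))

/-- The contributions of the pair `(v, w)` to the sum of the values of the lift at two points that
are symmetric with respect to the vertical line through the vertex `i`. -/
theorem exists_eventually_pair (i v w : V) [DecidableEq V] :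
    ∃ β : ℝ, ∀ᶠ u : ℝ × ℝ in nhds 0, 0 < u.1 →
      (if (p v).1 ≤ (p i).1 + u.1 ∧ (p i).1 + u.1 < (p w).1 then
        ω v w * |planeCross (p v) (p w) (p i + u)| else 0) +
      (if (p v).1 ≤ (p i).1 - u.1 ∧ (p i).1 - u.1 < (p w).1 then
        ω v w * |planeCross (p v) (p w) (p i + (-u.1, u.2))| else 0) =
      2 * (if (p v).1 ≤ (p i).1 ∧ (p i).1 < (p w).1 then
        ω v w * |planeCross (p v) (p w) (p i)| else 0) + 2 * β * u.2 +
      ((if v = i ∧ (p i).1 < (p w).1 then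
        ω i w * |(|(p w).1 - (p i).1| * u.2 - ((p w).2 - (p i).2) * u.1)| else 0) +
      (if w = i ∧ (p v).1 < (p i).1 then
        ω i v * |(|(p v).1 - (p i).1| * u.2 - ((p v).2 - (p i).2) * u.1)| else 0)) := by
  by_cases hω : ω v w = 0
  · refine ⟨0, Filter.Eventually.of_forall fun u _ => ?_⟩
    by_cases h1 : v = i
    · subst h1
      by_cases h2 : w = v
      · subst h2; simp [hω]
      · simp [hω, h2]
    · by_cases h2 : w = i
      · subst h2; rw [h.symm v w] at hω; simp [hω, h1, h.symm v w]
      · simp [hω, h1, h2]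
  by_cases hv : v = i
  · subst hv
    refine ⟨0, ?_⟩
    rcases lt_or_ge (p v).1 (p w).1 with hlt | hge
    · filter_upwards [eventually_fst_mem (X := p v) (sub_one_lt _) hlt] with u hu h0
      have hwv : w ≠ v := by rintro rfl; exact hlt.false
      rw [if_pos ⟨by linarith, hu.2.1⟩, if_neg (fun hc => by linarith [hc.1]),
        if_pos ⟨le_rfl, hlt⟩, if_pos ⟨rfl, hlt⟩, if_neg (fun hc => hwv hc.1),
        planeCross_add, abs_of_pos (sub_pos.2 hlt)]
      simp [planeCross]
    · refine Filter.Eventually.of_forall fun u h0 => ?_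
      rw [if_neg (fun hc => by linarith [hc.2]), if_neg (fun hc => by linarith [hc.1]),
        if_neg (fun hc => by linarith [hc.2]), if_neg (fun hc => by linarith [hc.2]),
        if_neg (fun hc => absurd (hc.1 ▸ hc.2) (lt_irrefl _))]
      simp
  by_cases hw : w = i
  · subst hw
    refine ⟨0, ?_⟩
    rcases lt_or_ge (p v).1 (p w).1 with hlt | hge
    · filter_upwards [eventually_fst_mem (X := p w) hlt (lt_add_one _)] with u hu h0
      rw [if_neg (fun hc => by linarith [hc.2]), if_pos ⟨hu.2.2.1.le, by linarith⟩,
        if_neg (fun hc => hc.2.false), if_neg (fun hc => hv hc.1), if_pos ⟨rfl, hlt⟩,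
        planeCross_add, abs_of_neg (sub_neg.2 hlt), h.symm v w]
      simp only [planeCross]
      ring_nf
    · refine Filter.Eventually.of_forall fun u h0 => ?_
      rw [if_neg (fun hc => by linarith [hc.2]), if_neg (fun hc => by linarith [hc.1]),
        if_neg (fun hc => by linarith [hc.2]), if_neg (fun hc => hv hc.1),
        if_neg (fun hc => by linarith [hc.2])]
      simp
  simp only [hv, hw, false_and, if_false, add_zero]
  rcases lt_or_gt_of_ne (h.fst_ne hv) with h1 | h1
  · rcases lt_or_gt_of_ne (h.fst_ne hw) with h2 | h2
    · refine ⟨0, ?_⟩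
      filter_upwards [eventually_fst_mem h2 (lt_add_one _)] with u hu _
      rw [if_neg (fun hc => by linarith [hc.2, hu.1]), if_neg (fun hc => by
        linarith [hc.2, hu.2.2.1]), if_neg (fun hc => by linarith [hc.2])]
      simp
    · have h0 := h.planeCross_vertex_ne_zero i v w hω h1 h2
      refine ⟨ω v w * SignType.sign (planeCross (p v) (p w) (p i)) * ((p w).1 - (p v).1), ?_⟩
      have t1 : Filter.Tendsto (fun u : ℝ × ℝ => planeCross (p v) (p w) (p i + u)) (nhds 0)
          (nhds (planeCross (p v) (p w) (p i))) := by
        have : Continuous fun u : ℝ × ℝ => planeCross (p v) (p w) (p i + u) :=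
          (continuous_planeCross _ _).comp (by fun_prop)
        simpa using this.tendsto 0
      have t2 : Filter.Tendsto (fun u : ℝ × ℝ => planeCross (p v) (p w) (p i + (-u.1, u.2)))
          (nhds 0) (nhds (planeCross (p v) (p w) (p i))) := by
        have : Continuous fun u : ℝ × ℝ => planeCross (p v) (p w) (p i + (-u.1, u.2)) :=
          (continuous_planeCross _ _).comp (by fun_prop)
        have h3 := this.tendsto 0
        simpa [← Prod.zero_eq_mk] using h3
      rcases lt_or_gt_of_ne h0 with h0 | h0
      · filter_upwards [eventually_fst_mem h1 h2, t1.eventually_lt_const h0,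
          t2.eventually_lt_const h0] with u hu hu1 hu2 _
        rw [if_pos ⟨hu.1.le, hu.2.1⟩, if_pos ⟨hu.2.2.1.le, hu.2.2.2⟩, if_pos ⟨h1.le, h2⟩,
          abs_of_neg hu1, abs_of_neg hu2, abs_of_neg h0, sign_neg h0, planeCross_add,
          planeCross_add]
        simp only [SignType.coe_neg_one]; ring
      · filter_upwards [eventually_fst_mem h1 h2, t1.eventually_const_lt h0,
          t2.eventually_const_lt h0] with u hu hu1 hu2 _
        rw [if_pos ⟨hu.1.le, hu.2.1⟩, if_pos ⟨hu.2.2.1.le, hu.2.2.2⟩, if_pos ⟨h1.le, h2⟩,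
          abs_of_pos hu1, abs_of_pos hu2, abs_of_pos h0, sign_pos h0, planeCross_add,
          planeCross_add]
        simp only [SignType.coe_one]; ring
  · refine ⟨0, ?_⟩
    filter_upwards [eventually_fst_mem (sub_one_lt _) h1] with u hu _
    rw [if_neg (fun hc => by linarith [hc.1, hu.2.1]), if_neg (fun hc => by
      linarith [hc.1, hu.2.2.2]), if_neg (fun hc => by linarith [hc.1])]
    simp

theorem exists_eventually_vertex (i : V) :
    ∃ β : ℝ, ∀ᶠ u : ℝ × ℝ in nhds 0, 0 < u.1 →
      stressLift p ω (p i + u) + stressLift p ω (p i + (-u.1, u.2)) =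
      2 * stressLift p ω (p i) + 2 * β * u.2 +
      ∑ w, ω i w * |(|(p w).1 - (p i).1| * u.2 - ((p w).2 - (p i).2) * u.1)| := by
  classical
  choose β hβ using fun v w => h.exists_eventually_pair i v w
  refine ⟨∑ v, ∑ w, β v w, ?_⟩
  filter_upwards [Filter.eventually_all.2 fun v => Filter.eventually_all.2 (hβ v)] with u hu h0
  have hq : ∑ w, ω i w * |(|(p w).1 - (p i).1| * u.2 - ((p w).2 - (p i).2) * u.1)| =
      ∑ v, ∑ w, ((if v = i ∧ (p i).1 < (p w).1 then
        ω i w * |(|(p w).1 - (p i).1| * u.2 - ((p w).2 - (p i).2) * u.1)| else 0) +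
      (if w = i ∧ (p v).1 < (p i).1 then
        ω i v * |(|(p v).1 - (p i).1| * u.2 - ((p v).2 - (p i).2) * u.1)| else 0)) := by
    simp only [ite_and, Finset.sum_add_distrib, Finset.sum_ite_eq', Finset.mem_univ, if_true]
    rw [Finset.sum_comm]
    simp only [Finset.sum_ite_eq', Finset.mem_univ, if_true]
    rw [← Finset.sum_add_distrib]
    refine Finset.sum_congr rfl fun w _ => ?_
    rcases lt_trichotomy (p w).1 (p i).1 with h1 | h1 | h1
    · simp [h1, h1.le]
    · rw [h.fst_injective h1]; simp
    · simp [h1, h1.le]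
  rw [hq]
  simp only [stressLift_eq_sliceLift h.symm, sliceLift, Finset.mul_sum, Finset.sum_mul,
    ← Finset.sum_add_distrib, Prod.fst_add]
  exact Finset.sum_congr rfl fun v _ => Finset.sum_congr rfl fun w _ => hu v w h0

end IsPlaneBalancedStress

theorem integral_abs_mul_sin_sub_mul_cos (A B : ℝ) :
    ∫ θ in (-(Real.pi / 2))..(Real.pi / 2), |A * Real.sin θ - B * Real.cos θ| =
      2 * √(A ^ 2 + B ^ 2) := by
  obtain ⟨φ, hA, hB⟩ : ∃ φ,
      A = √(A ^ 2 + B ^ 2) * Real.cos φ ∧ B = √(A ^ 2 + B ^ 2) * Real.sin φ := by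
    refine ⟨Complex.arg ⟨A, B⟩, ?_, ?_⟩
    · have := Complex.norm_mul_cos_arg ⟨A, B⟩
      rw [Complex.norm_eq_sqrt_sq_add_sq] at this
      exact this.symm
    · have := Complex.norm_mul_sin_arg ⟨A, B⟩
      rw [Complex.norm_eq_sqrt_sq_add_sq] at this
      exact this.symm
  have hR := Real.sqrt_nonneg (A ^ 2 + B ^ 2)
  generalize √(A ^ 2 + B ^ 2) = R at *
  have h1 : ∀ θ, |A * Real.sin θ - B * Real.cos θ| = R * |Real.sin (θ - φ)| := fun θ => by
    have := abs_mul R (Real.sin (θ - φ))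
    rw [abs_of_nonneg hR] at this
    rw [← this, Real.sin_sub]
    congr 1
    linear_combination Real.sin θ * hA - Real.cos θ * hB
  have h2 : Function.Periodic (fun θ => |Real.sin (θ - φ)|) Real.pi := fun θ => by
    simp only [add_sub_right_comm, Real.sin_add_pi, abs_neg]
  have h3 := h2.intervalIntegral_add_eq (-(Real.pi / 2)) φ
  rw [show -(Real.pi / 2) + Real.pi = Real.pi / 2 by ring,
    intervalIntegral.integral_comp_sub_right (fun θ => |Real.sin θ|),
    intervalIntegral.integral_comp_sub_right (fun θ => |Real.sin θ|)] at h3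
  simp only [sub_self, add_sub_cancel_left] at h3
  have h4 : ∫ θ in (0 : ℝ)..Real.pi, |Real.sin θ| = 2 := by
    rw [show (2 : ℝ) = ∫ θ in (0 : ℝ)..Real.pi, Real.sin θ by rw [integral_sin]; norm_num]
    refine intervalIntegral.integral_congr fun θ hθ => ?_
    rw [Set.uIcc_of_le Real.pi_nonneg] at hθ
    exact abs_of_nonneg (Real.sin_nonneg_of_mem_Icc hθ)
  simp only [h1, intervalIntegral.integral_const_mul]
  rw [intervalIntegral.integral_comp_sub_right (fun θ => |Real.sin θ|), h3, h4, mul_comm]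

namespace IsPlaneBalancedStress

variable {V : Type*} [Fintype V] {p : V → ℝ × ℝ} {ω : V → V → ℝ} (h : IsPlaneBalancedStress p ω)
include h

theorem exists_second_difference_nonneg_of_vertex (i : V)
    (hmax : ∀ Y, stressLift p ω Y ≤ stressLift p ω (p i)) :
    ∃ u, u ≠ 0 ∧
      2 * stressLift p ω (p i) ≤ stressLift p ω (p i + u) + stressLift p ω (p i - u) := by
  obtain ⟨β, hβ⟩ := h.exists_eventually_vertex i
  obtain ⟨δ, hδ, hβ⟩ := Metric.eventually_nhds_iff.1 hβ
  obtain ⟨ε, hε, hεδ⟩ := exists_between hδ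
  refine ⟨(ε, 0), by simp [hε.ne'], ?_⟩
  by_contra! hlt
  let g : ℝ → ℝ := fun θ => 2 * stressLift p ω (p i) -
    (stressLift p ω (p i + (ε * Real.cos θ, ε * Real.sin θ)) +
      stressLift p ω (p i + (-(ε * Real.cos θ), ε * Real.sin θ)))
  have hg : Continuous g := by
    have := h.continuous_stressLift
    fun_prop
  have hpos : 0 < ∫ θ in (-(Real.pi / 2))..(Real.pi / 2), g θ := by
    refine intervalIntegral.integral_pos (by linarith [Real.pi_pos]) hg.continuousOn
      (fun θ _ => ?_) ⟨0, ⟨by linarith [Real.pi_pos], by linarith [Real.pi_pos]⟩, ?_⟩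
    · have h1 := hmax (p i + (ε * Real.cos θ, ε * Real.sin θ))
      have h2 := hmax (p i + (-(ε * Real.cos θ), ε * Real.sin θ))
      simp only [g]
      linarith
    · simp only [g, Real.cos_zero, Real.sin_zero, mul_one, mul_zero]
      rw [sub_eq_add_neg, Prod.neg_mk, neg_zero] at hlt
      linarith
  have hzero : ∫ θ in (-(Real.pi / 2))..(Real.pi / 2), g θ = 0 := by
    have h1 : ∫ θ in (-(Real.pi / 2))..(Real.pi / 2), g θ =
        ∫ θ in (-(Real.pi / 2))..(Real.pi / 2), (-(2 * β * ε) * Real.sin θ -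
          ∑ w, (ε * ω i w) * |(|(p w).1 - (p i).1| * Real.sin θ -
            ((p w).2 - (p i).2) * Real.cos θ)|) := by
      refine intervalIntegral.integral_congr_Ioo_of_le (by linarith [Real.pi_pos]) fun θ hθ => ?_
      have hc := Real.cos_pos_of_mem_Ioo hθ
      have h2 := @hβ (ε * Real.cos θ, ε * Real.sin θ) (by
        rw [dist_zero_right, Prod.norm_mk, max_lt_iff, Real.norm_eq_abs, Real.norm_eq_abs, abs_mul,
          abs_mul, abs_of_pos hε]
        constructor
        · nlinarith [Real.abs_cos_le_one θ]
        · nlinarith [Real.abs_sin_le_one θ]) (mul_pos hε hc)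
      simp only [g]
      rw [h2, show ∀ a b c : ℝ, 2 * a - (2 * a + b + c) = -b - c by intros; ring]
      congr 1
      · ring
      · refine Finset.sum_congr rfl fun w _ => ?_
        rw [mul_left_comm _ ε, mul_left_comm _ ε, ← mul_sub, abs_mul, abs_of_pos hε]
        ring
    rw [h1, intervalIntegral.integral_sub (Continuous.intervalIntegrable (by fun_prop) _ _)
      (Continuous.intervalIntegrable (by fun_prop) _ _), intervalIntegral.integral_const_mul,
      integral_sin, Real.cos_neg, sub_self, mul_zero, zero_sub, neg_eq_zero,
      intervalIntegral.integral_finsetSum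
        fun w _ => Continuous.intervalIntegrable (by fun_prop) _ _]
    simp only [intervalIntegral.integral_const_mul, integral_abs_mul_sin_sub_mul_cos, sq_abs]
    have h3 := h.sum_length i
    calc _ = (2 * ε) * ∑ w, ω i w * √(((p w).1 - (p i).1) ^ 2 + ((p w).2 - (p i).2) ^ 2) := by
          rw [Finset.mul_sum]; exact Finset.sum_congr rfl fun w _ => by ring
      _ = 0 := by rw [h3, mul_zero]
  exact hpos.ne' hzero

theorem stressLift_nonpos (X : ℝ × ℝ) : stressLift p ω X ≤ 0 := by
  by_contra! hX
  obtain ⟨Z, hmax, hZ⟩ := exists_isMax_of_hasCompactSupport h.continuous_stressLift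
    h.hasCompactSupport_stressLift ⟨X, hX⟩
  by_cases hv : ∃ i, p i = Z
  · obtain ⟨i, rfl⟩ := hv
    obtain ⟨u, hu, hle⟩ := h.exists_second_difference_nonneg_of_vertex i hmax
    exact (hZ u hu).not_ge hle
  · push Not at hv
    obtain ⟨u, hu, he⟩ := h.exists_second_difference_eq_zero hv
    exact (hZ u hu).ne he

theorem stressLift_eq_zero (X : ℝ × ℝ) : stressLift p ω X = 0 := by
  have := h.neg.stressLift_nonpos X
  rw [stressLift_neg] at this
  linarith [h.stressLift_nonpos X]

theorem eq_zero_of_fst_lt {v w : V} (hvw : (p v).1 < (p w).1) : ω v w = 0 := by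
  by_contra hω
  let X : ℝ × ℝ := (((p v).1 + (p w).1) / 2, ((p v).2 + (p w).2) / 2)
  have h0 : planeCross (p v) (p w) X = 0 := by simp only [planeCross, X]; ring
  have h1 : (p v).1 < X.1 := by simp only [X]; linarith
  have h2 : X.1 < (p w).1 := by simp only [X]; linarith
  have hX : ∀ i, p i ≠ X := fun i hi =>
    h.planeCross_vertex_ne_zero i v w hω (hi ▸ h1) (hi ▸ h2) (hi ▸ h0)
  obtain ⟨t, ht, ht0⟩ := ((Filter.Eventually.filter_mono nhdsWithin_le_nhds
    (h.eventually_second_difference hX (0, 1))).and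
    (self_mem_nhdsWithin : {(0 : ℝ)}ᶜ ∈ nhdsWithin 0 {(0 : ℝ)}ᶜ)).exists
  simp only [h.stressLift_eq_zero, add_zero, mul_zero, sub_zero, mul_one] at ht
  rw [Finset.sum_eq_single v, Finset.sum_eq_single w, if_pos ⟨⟨h1.le, h2⟩, h0⟩] at ht
  · have : 0 < |t| := abs_pos.2 ht0
    have h3 : 0 < |(p w).1 - (p v).1| := abs_pos.2 (sub_pos.2 hvw).ne'
    exact mul_ne_zero hω (by positivity) ht.symm
  · intro w' _ hw'
    split_ifs with hc
    · by_cases hω' : ω v w' = 0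
      · simp [hω']
      · exact absurd (h.eq_of_planeCross_eq_zero v w' v w X hω' hω h1 hc.1.2 h1 h2 hc.2 h0).2 hw'
    · rfl
  · simp
  · intro v' _ hv'
    refine Finset.sum_eq_zero fun w' _ => ?_
    split_ifs with hc
    · by_cases hω' : ω v' w' = 0
      · simp [hω']
      · exact absurd (h.eq_of_planeCross_eq_zero v' w' v w X hω' hω
          (fst_lt_of_planeCross_eq_zero (hX v') hc.1 hc.2) hc.1.2 h1 h2 hc.2 h0).1 hv'
    · rfl
  · simp

theorem eq_zero {v w : V} (hvw : v ≠ w) : ω v w = 0 := by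
  rcases lt_or_gt_of_ne (h.fst_ne hvw) with hlt | hlt
  · exact h.eq_zero_of_fst_lt hlt
  · rw [h.symm]; exact h.eq_zero_of_fst_lt hlt

end IsPlaneBalancedStress

theorem wbtw_of_planeCross_eq_zero {E : Type*} [AddCommGroup E] [Module ℝ E]
    (φ : E ≃ₗ[ℝ] ℝ × ℝ) {A B X : E} (h1 : (φ A).1 < (φ X).1) (h2 : (φ X).1 < (φ B).1)
    (h : planeCross (φ A) (φ B) (φ X) = 0) : Wbtw ℝ A X B := by
  have h3 : 0 < (φ B).1 - (φ A).1 := by linarith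
  refine ⟨((φ X).1 - (φ A).1) / ((φ B).1 - (φ A).1),
    ⟨div_nonneg (by linarith) h3.le, (div_le_one h3).2 (by linarith)⟩, φ.injective ?_⟩
  rw [AffineMap.lineMap_apply_module', map_add, map_smul, map_sub]
  unfold planeCross at h
  ext
  · simp only [Prod.fst_add, Prod.smul_fst, Prod.fst_sub, smul_eq_mul]
    field_simp; ring
  · simp only [Prod.snd_add, Prod.smul_snd, Prod.snd_sub, smul_eq_mul]
    field_simp; linarith

theorem exists_linearEquiv_injective_fst {V : Type*} [Finite V]
    {p : V → EuclideanSpace ℝ (Fin 2)} (hp : Function.Injective p) :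
    ∃ (φ : EuclideanSpace ℝ (Fin 2) ≃ₗ[ℝ] ℝ × ℝ) (s : ℝ),
      (∀ x, √((φ x).1 ^ 2 + (φ x).2 ^ 2) = s * ‖x‖) ∧ Function.Injective fun v => (φ (p v)).1 := by
  obtain ⟨t, ht⟩ := (Set.finite_range fun e : V × V =>
    -(p e.1 0 - p e.2 0) / (p e.1 1 - p e.2 1)).exists_notMem
  have h0 : 1 + t ^ 2 ≠ 0 := by positivity
  let φ : EuclideanSpace ℝ (Fin 2) ≃ₗ[ℝ] ℝ × ℝ :=
    { toFun x := (x 0 + t * x 1, x 1 - t * x 0)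
      map_add' x y := by ext <;> simp <;> ring
      map_smul' c x := by ext <;> simp <;> ring
      invFun y := !₂[(y.1 - t * y.2) / (1 + t ^ 2), (y.2 + t * y.1) / (1 + t ^ 2)]
      left_inv x := by
        ext i; fin_cases i <;> simp <;> field_simp <;> ring
      right_inv y := by ext <;> simp <;> field_simp <;> ring }
  refine ⟨φ, √(1 + t ^ 2), fun x => ?_, fun v w hvw => hp ?_⟩
  · rw [EuclideanSpace.norm_eq, ← Real.sqrt_mul (by positivity), Fin.sum_univ_two]
    congr 1
    simp only [φ, LinearEquiv.coe_mk, LinearMap.coe_mk, AddHom.coe_mk, Real.norm_eq_abs, sq_abs]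
    ring
  · have h1 : p v 0 + t * p v 1 = p w 0 + t * p w 1 := hvw
    have h2 : p v 1 = p w 1 := by
      by_contra h2
      refine ht ⟨(v, w), ?_⟩
      have := sub_ne_zero.2 h2
      simp only
      field_simp
      linarith
    ext i
    fin_cases i
    · simpa [h2] using h1
    · exact h2

section Discs

variable {V E : Type*} [NormedAddCommGroup E] [NormedSpace ℝ E] [StrictConvexSpace ℝ E]
  {p : V → E} {r : V → ℝ}

theorem not_dist_sub_add_le (hr : ∀ v, 0 < r v) (hp : ∀ v w, v ≠ w → r v + r w ≤ dist (p v) (p w))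
    {v w k : V} {X : E} (hvw : v ≠ w) (hvk : v ≠ k) (hwk : w ≠ k) (hX : X ≠ p v)
    (hw : dist X (p v) - r v + (dist X (p w) - r w) ≤ 0) :
    0 < dist X (p v) - r v + (dist X (p k) - r k) := by
  by_contra! hk
  have key : ∀ l, v ≠ l → dist X (p v) - r v + (dist X (p l) - r l) ≤ 0 →
      SameRay ℝ (X - p v) (p l - p v) ∧ ‖p l - p v‖ = r v + r l := by
    intro l hl hle
    have h1 := hp v l hl
    have h2 := dist_triangle (p v) X (p l)
    rw [dist_comm (p v) X] at h2
    refine ⟨(dist_add_dist_eq_iff.1 ?_ : Wbtw ℝ (p v) X (p l)).sameRay_vsub_left, ?_⟩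
    · rw [dist_comm (p v) X]; linarith
    · rw [← dist_eq_norm, dist_comm]; linarith
  obtain ⟨r1, n1⟩ := key w hvw hw
  obtain ⟨r2, n2⟩ := key k hvk hk
  have h3 := (r1.symm.trans r2 fun h => absurd (sub_eq_zero.1 h) hX).norm_sub
  rw [sub_sub_sub_cancel_right, ← dist_eq_norm, n1, n2] at h3
  have h4 := hp w k hwk
  rw [h3, add_sub_add_left_eq_sub] at h4
  rcases abs_cases (r w - r k) with h5 | h5 <;> linarith [hr w, hr k]

theorem eq_or_eq_of_wbtw (hr : ∀ v, 0 < r v) (hp : ∀ v w, v ≠ w → r v + r w ≤ dist (p v) (p w))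
    {v w v' w' : V} {X : E} (hvw : v ≠ w) (hvw' : v' ≠ w') (hd : dist (p v) (p w) = r v + r w)
    (hd' : dist (p v') (p w') = r v' + r w') (h : Wbtw ℝ (p v) X (p w))
    (h' : Wbtw ℝ (p v') X (p w')) (hX : ∀ k, X ≠ p k) :
    v = v' ∧ w = w' ∨ v = w' ∧ w = v' := by
  have e1 := h.dist_add_dist
  have e2 := h'.dist_add_dist
  rw [dist_comm (p v) X] at e1
  rw [dist_comm (p v') X] at e2
  have hle : ∀ k l, k ≠ l → 0 ≤ dist X (p k) - r k + (dist X (p l) - r l) := fun k l hkl => by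
    have := dist_triangle (p k) X (p l)
    rw [dist_comm (p k) X] at this
    linarith [hp k l hkl]
  have core := fun {v w k : V} (h1 : v ≠ w) (h2 : v ≠ k) (h3 : w ≠ k) =>
    not_dist_sub_add_le hr hp h1 h2 h3 (hX v)
  by_cases h1 : v = v'
  · subst h1
    refine .inl ⟨rfl, by_contra fun h2 => ?_⟩
    linarith [core hvw hvw' h2 (by linarith)]
  by_cases h2 : v = w'
  · subst h2
    refine .inr ⟨rfl, by_contra fun h2 => ?_⟩
    linarith [core hvw (Ne.symm hvw') h2 (by linarith)]
  by_cases h3 : w = v'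
  · subst h3
    refine .inr ⟨by_contra fun h2 => ?_, rfl⟩
    linarith [core (Ne.symm hvw) hvw' h2 (by linarith)]
  by_cases h4 : w = w'
  · subst h4
    refine .inl ⟨by_contra fun h2 => ?_, rfl⟩
    linarith [core (Ne.symm hvw) (Ne.symm hvw') h2 (by linarith)]
  have := core hvw h1 h3 (by linarith)
  linarith [hle v v' h1, hle v w' h2, hle w v' h3, hle w w' h4]

end Discs

theorem IsPlaneBalancedStress.of_discs {V : Type*} [Fintype V]
    {p : V → EuclideanSpace ℝ (Fin 2)} {r : V → ℝ} {σ : V → V → ℝ} (hr : ∀ v, 0 < r v)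
    (hp : ∀ v w, v ≠ w → r v + r w ≤ dist (p v) (p w)) (hσ : ∀ v w, σ v w = σ w v)
    (hd : ∀ v w, v ≠ w → σ v w ≠ 0 → dist (p v) (p w) = r v + r w)
    (heq : ∀ v, ∑ w, σ v w • (p v - p w) = 0) (hlen : ∀ v, ∑ w, σ v w * dist (p v) (p w) = 0)
    (φ : EuclideanSpace ℝ (Fin 2) ≃ₗ[ℝ] ℝ × ℝ) {s : ℝ}
    (hφ : ∀ x, √((φ x).1 ^ 2 + (φ x).2 ^ 2) = s * ‖x‖)
    (hinj : Function.Injective fun v => (φ (p v)).1) :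
    IsPlaneBalancedStress (fun v => φ (p v)) σ := by
  have hsum : ∀ v, ∑ w, σ v w • (φ (p w) - φ (p v)) = 0 := fun v => by
    have := congrArg (fun x => -φ x) (heq v)
    simp only [map_sum, map_smul, map_sub, map_zero, neg_zero, ← Finset.sum_neg_distrib,
      ← smul_neg, neg_sub] at this
    exact this
  have hne : ∀ {v w : V}, (φ (p v)).1 < (φ (p w)).1 → v ≠ w := by
    rintro v _ hlt rfl; exact hlt.false
  refine ⟨hinj, hσ, fun v => ?_, fun v => ?_, fun v => ?_, fun i v w hω h1 h2 h0 => ?_,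
    fun v w v' w' X hω hω' h1 h2 h1' h2' h0 h0' => ?_⟩
  · simpa [Prod.fst_sum] using congrArg Prod.fst (hsum v)
  · simpa [Prod.snd_sum] using congrArg Prod.snd (hsum v)
  · calc _ = s * ∑ w, σ v w * dist (p v) (p w) := by
          rw [Finset.mul_sum]
          refine Finset.sum_congr rfl fun w _ => ?_
          have := hφ (p w - p v)
          rw [map_sub, Prod.fst_sub, Prod.snd_sub] at this
          rw [this, dist_comm, dist_eq_norm]; ring
      _ = 0 := by rw [hlen, mul_zero]
  · have := (wbtw_of_planeCross_eq_zero φ h1 h2 h0).dist_add_dist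
    linarith [hp v i (hne h1), hp i w (hne h2), hd v w (hne (h1.trans h2)) hω, hr i]
  · obtain ⟨X, rfl⟩ := φ.surjective X
    have hw := wbtw_of_planeCross_eq_zero φ h1 h2 h0
    have hw' := wbtw_of_planeCross_eq_zero φ h1' h2' h0'
    have hX : ∀ k, X ≠ p k := by
      rintro k rfl
      have := hw.dist_add_dist
      linarith [hp v k (hne h1), hp k w (hne h2), hd v w (hne (h1.trans h2)) hω, hr k]
    rcases eq_or_eq_of_wbtw hr hp (hne (h1.trans h2)) (hne (h1'.trans h2'))
      (hd v w (hne (h1.trans h2)) hω) (hd v' w' (hne (h1'.trans h2')) hω') hw hw' hX with h | h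
    · exact h
    · rw [← h.2] at h1'; exact absurd h1' h2.not_gt

theorem sum_sum_mul_sub_eq_zero {V : Type*} [Fintype V] {a : V → V → ℝ}
    (ha : ∀ v w, a w v = -a v w) (h0 : ∀ v, ∑ w, a v w = 0) (c : V → ℝ) :
    ∑ v, ∑ w, a v w * (c v - c w) = 0 := by
  have h1 : ∑ v, ∑ w, a v w * c v = 0 := by
    simp only [← Finset.sum_mul, h0, zero_mul, Finset.sum_const_zero]
  have h2 : ∑ v, ∑ w, a v w * c w = 0 := by
    rw [Finset.sum_comm, ← neg_eq_zero, ← h1]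
    simp only [← Finset.sum_neg_distrib]
    exact Finset.sum_congr rfl fun v _ => Finset.sum_congr rfl fun w _ => by rw [ha v w]; ring
  simp only [mul_sub, Finset.sum_sub_distrib, h1, h2, sub_self]

theorem sum_mul_dist_eq_zero {V : Type*} [Fintype V] {p : V → EuclideanSpace ℝ (Fin 2)}
    {r : V → ℝ} {σ : V → V → ℝ} (hr : AlgebraicIndependent ℚ r) (hσ : ∀ v w, σ v w = σ w v)
    (hd : ∀ v w, v ≠ w → σ v w ≠ 0 → dist (p v) (p w) = r v + r w)
    (heq : ∀ v, ∑ w, σ v w • (p v - p w) = 0) (k : V) : ∑ w, σ k w * dist (p k) (p w) = 0 := by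
  classical
  obtain ⟨D, hD⟩ := hr.exists_derivation (Pi.single k 1)
  have hcoord : ∀ j v, ∑ w, σ v w * (p v j - p w j) = 0 := fun j v => by
    simpa using congrArg (fun x : EuclideanSpace ℝ (Fin 2) => x j) (heq v)
  have hzero : ∀ j, ∑ v, ∑ w, σ v w * (p v j - p w j) * (D (p v j) - D (p w j)) = 0 := fun j =>
    sum_sum_mul_sub_eq_zero (fun v w => by rw [hσ]; ring) (hcoord j) fun v => D (p v j)
  have hpair : ∀ v w, σ v w * (p v 0 - p w 0) * (D (p v 0) - D (p w 0)) +
      σ v w * (p v 1 - p w 1) * (D (p v 1) - D (p w 1)) =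
      σ v w * dist (p v) (p w) * D (r v) + σ v w * dist (p v) (p w) * D (r w) := by
    intro v w
    by_cases hvw : v = w
    · simp [hvw]
    by_cases h0 : σ v w = 0
    · simp [h0]
    have h1 : (p v 0 - p w 0) * (p v 0 - p w 0) + (p v 1 - p w 1) * (p v 1 - p w 1) =
        (r v + r w) * (r v + r w) := by
      rw [← hd v w hvw h0, dist_eq_norm, ← pow_two ‖_‖, EuclideanSpace.real_norm_sq_eq,
        Fin.sum_univ_two]
      simp only [PiLp.sub_apply]
      ring
    have h2 := congrArg D h1
    simp only [map_add, Derivation.leibniz, map_sub, smul_eq_mul] at h2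
    rw [hd v w hvw h0]
    linear_combination (σ v w / 2) * h2
  have h1 : ∑ v, ∑ w, σ v w * dist (p v) (p w) * D (r v) = ∑ w, σ k w * dist (p k) (p w) := by
    simp [hD, Pi.single_apply]
  have h2 : ∑ v, ∑ w, σ v w * dist (p v) (p w) * D (r w) = ∑ w, σ k w * dist (p k) (p w) := by
    rw [Finset.sum_comm, ← h1]
    exact Finset.sum_congr rfl fun v _ => Finset.sum_congr rfl fun w _ => by
      rw [hσ, dist_comm]
  have h3 := Finset.sum_congr rfl fun v (_ : v ∈ Finset.univ) =>
    Finset.sum_congr rfl fun w (_ : w ∈ Finset.univ) => hpair v w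
  simp only [Finset.sum_add_distrib, hzero, h1, h2] at h3
  linarith
section EdgeCount

variable {V : Type*}

open Classical in
/-- The value at the pair `(v, w)` of a weight on the edges of `G`. -/
def edgeWeight (G : SimpleGraph V) (v w : V) : (G.edgeSet → ℝ) →ₗ[ℝ] ℝ :=
  if h : G.Adj v w then LinearMap.proj ⟨s(v, w), h⟩ else 0

theorem edgeWeight_comm (G : SimpleGraph V) (v w : V) (f : G.edgeSet → ℝ) :
    edgeWeight G v w f = edgeWeight G w v f := by
  by_cases h : G.Adj v w
  · simp [edgeWeight, h, h.symm, Sym2.eq_swap (a := v)]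
  · simp [edgeWeight, h, mt G.adj_symm h]

variable [Fintype V]

/-- The forces exerted on the vertices by a weight on the edges of `G`: the transpose of the
rigidity map. -/
def edgeForce (G : SimpleGraph V) {d : ℕ} (p : V → EuclideanSpace ℝ (Fin d)) :
    (G.edgeSet → ℝ) →ₗ[ℝ] V → EuclideanSpace ℝ (Fin d) :=
  LinearMap.pi fun v => ∑ w, (edgeWeight G v w).smulRight (p v - p w)

theorem edgeForce_apply (G : SimpleGraph V) {d : ℕ} (p : V → EuclideanSpace ℝ (Fin d))
    (f : G.edgeSet → ℝ) (v : V) :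
    edgeForce G p f v = ∑ w, edgeWeight G v w f • (p v - p w) := by
  simp [edgeForce]

theorem IsStressFree.injective_edgeForce {G : SimpleGraph V} {d : ℕ}
    {p : V → EuclideanSpace ℝ (Fin d)} (h : IsStressFree G p) :
    Function.Injective (edgeForce G p) := by
  rw [injective_iff_map_eq_zero]
  intro f hf
  have := h (fun v w => edgeWeight G v w f) (fun v w => edgeWeight_comm G v w f)
    (fun v w hvw => by simp [edgeWeight, hvw])
    fun v => by rw [← edgeForce_apply, hf, Pi.zero_apply]
  ext ⟨e, he⟩
  induction e using Sym2.ind with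
  | _ v w =>
    have h1 := this v w
    simpa [edgeWeight, (G.mem_edgeSet.1 he)] using h1

/-- The force and the torque about the origin of a force applied at the point `A`. -/
def wrench (A : EuclideanSpace ℝ (Fin 2)) : EuclideanSpace ℝ (Fin 2) →ₗ[ℝ] ℝ × ℝ × ℝ where
  toFun x := (x 0, x 1, A 0 * x 1 - A 1 * x 0)
  map_add' x y := by ext <;> simp; ring
  map_smul' c x := by ext <;> simp; ring

open Classical in
/-- The total force and torque of a system of forces applied at the points `p v`. -/
def totalWrench (p : V → EuclideanSpace ℝ (Fin 2)) :
    (V → EuclideanSpace ℝ (Fin 2)) →ₗ[ℝ] ℝ × ℝ × ℝ :=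
  LinearMap.lsum ℝ _ ℝ fun v => wrench (p v)

theorem totalWrench_apply (p F : V → EuclideanSpace ℝ (Fin 2)) :
    totalWrench p F =
      (∑ v, F v 0, ∑ v, F v 1, ∑ v, (p v 0 * F v 1 - p v 1 * F v 0)) := by
  simp [totalWrench, wrench, Prod.ext_iff, Prod.fst_sum, Prod.snd_sum]

theorem totalWrench_surjective {p : V → EuclideanSpace ℝ (Fin 2)} {v w : V} (hvw : p v ≠ p w) :
    Function.Surjective (totalWrench p) := by
  classical
  rintro ⟨a, b, c⟩
  have hpos : (p w 0 - p v 0) ^ 2 + (p w 1 - p v 1) ^ 2 ≠ 0 := by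
    intro h0
    refine hvw (PiLp.ext fun i => ?_)
    fin_cases i
    · simp only [Fin.zero_eta]; nlinarith [sq_nonneg (p w 0 - p v 0), sq_nonneg (p w 1 - p v 1)]
    · simp only [Fin.mk_one]; nlinarith [sq_nonneg (p w 0 - p v 0), sq_nonneg (p w 1 - p v 1)]
  obtain ⟨l, hl⟩ : ∃ l, l * ((p w 0 - p v 0) ^ 2 + (p w 1 - p v 1) ^ 2) =
    c - (p v 0 * b - p v 1 * a) := ⟨_, div_mul_cancel₀ _ hpos⟩
  refine ⟨Pi.single v !₂[a + l * (p w 1 - p v 1), b - l * (p w 0 - p v 0)] +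
    Pi.single w !₂[-(l * (p w 1 - p v 1)), l * (p w 0 - p v 0)], ?_⟩
  rw [map_add, totalWrench, LinearMap.lsum_piSingle, LinearMap.lsum_piSingle]
  simp only [wrench, LinearMap.coe_mk, AddHom.coe_mk, Prod.mk_add_mk, Prod.mk.injEq,
    Matrix.cons_val_zero, Matrix.cons_val_one]
  refine ⟨by ring, by ring, by linear_combination hl⟩

theorem totalWrench_edgeForce (G : SimpleGraph V) (p : V → EuclideanSpace ℝ (Fin 2))
    (f : G.edgeSet → ℝ) : totalWrench p (edgeForce G p f) = 0 := by
  have h : ∀ j v, edgeForce G p f v j = ∑ w, edgeWeight G v w f * (p v j - p w j) := fun j v => by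
    simp [edgeForce_apply]
  rw [totalWrench_apply]
  simp only [h, Finset.mul_sum, ← Finset.sum_sub_distrib]
  rw [sum_sum_eq_zero_of_antisymm, sum_sum_eq_zero_of_antisymm, sum_sum_eq_zero_of_antisymm]
  · rfl
  all_goals intro v w; rw [edgeWeight_comm G w v]; ring

theorem IsStressFree.ncard_edgeSet_le {G : SimpleGraph V} {p : V → EuclideanSpace ℝ (Fin 2)}
    (h : IsStressFree G p) {v w : V} (hvw : p v ≠ p w) :
    G.edgeSet.ncard + 3 ≤ 2 * Fintype.card V := by
  classical
  have h1 := LinearMap.finrank_range_of_inj h.injective_edgeForce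
  have h2 : LinearMap.range (edgeForce G p) ≤ LinearMap.ker (totalWrench p) := by
    rintro _ ⟨f, rfl⟩
    exact totalWrench_edgeForce G p f
  have h3 := Submodule.finrank_mono h2
  have h4 := (totalWrench p).finrank_range_add_finrank_ker
  rw [LinearMap.range_eq_top.2 (totalWrench_surjective hvw), finrank_top] at h4
  simp only [Module.finrank_prod, Module.finrank_self, Module.finrank_pi_fintype,
    finrank_euclideanSpace_fin, Finset.sum_const, Finset.card_univ, smul_eq_mul] at h1 h4
  rw [← Nat.card_coe_set_eq, Nat.card_eq_fintype_card]
  rw [mul_one] at h1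
  omega

end EdgeCount

/-- Connelly–Gortler–Theran: every circle packing with generic radii is stress-free,
and hence has at most `2|V| − 3` contacts when `|V| ≥ 2`. -/
theorem circle_packing_generic_stressFree {V : Type*} [Fintype V] (G : SimpleGraph V)
    (p : V → EuclideanSpace ℝ (Fin 2)) (r : V → ℝ)
    (hP : IsSpherePacking 2 G p r) (hr : GenericRadii r) :
    IsStressFree G p ∧
    (2 ≤ Fintype.card V → (G.edgeSet.ncard : ℤ) ≤ 2 * Fintype.card V - 3) := by
  have hp : Function.Injective p := fun v w hvw => by
    by_contra hne
    have := (hP.2 v w hne).1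
    rw [hvw, dist_self] at this
    linarith [hP.1 v, hP.1 w]
  have hfree : IsStressFree G p := by
    intro σ hσ hadj heq v w
    by_cases hvw : v = w
    · exact hadj v w (hvw ▸ G.irrefl)
    have hd : ∀ v w, v ≠ w → σ v w ≠ 0 → dist (p v) (p w) = r v + r w := fun v w hne h0 =>
      (hP.2 v w hne).2.2 (by_contra fun h => h0 (hadj v w h))
    obtain ⟨φ, s, hφ, hinj⟩ := exists_linearEquiv_injective_fst hp
    exact (IsPlaneBalancedStress.of_discs hP.1 (fun v w hne => (hP.2 v w hne).1) hσ hd heq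
      (sum_mul_dist_eq_zero hr.2 hσ hd heq) φ hφ hinj).eq_zero hvw
  refine ⟨hfree, fun hV => ?_⟩
  obtain ⟨v, w, hvw⟩ := Fintype.exists_pair_of_one_lt_card hV
  have := hfree.ncard_edgeSet_le (hp.ne hvw)
  omega

end
end
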